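/- For all integers r ≥ 4 and p ≥ 4r + 2, the Ramsey number satisfies r(C_p, K_r) = (p − 1)(r − 1) + 1. -/

import Mathlib

open SimpleGraph

/-- `G` contains a cycle of order (number of vertices) `n`. -/
def hasCycleOfOrder {V : Type*} (G : SimpleGraph V) (n : ℕ) : Prop :=
  ∃ (v : V) (c : G.Walk v v), c.IsCycle ∧ c.length = n

/-- `G` has an independent set of size `r`. -/
def hasIndepSetOfSize {V : Type*} (G : SimpleGraph V) (r : ℕ) : Prop :=
  ∃ s : Finset V, s.card = r ∧ ∀ x ∈ s, ∀ y ∈ s, x ≠ y → ¬ G.Adj x y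


/-- `l` lists the vertices of a path from `u` to `v`. -/
structure LP {V : Type*} (G : SimpleGraph V) (u v : V) (l : List V) : Prop where
  chain : l.IsChain G.Adj
  nodup : l.Nodup
  hd : l.head? = some u
  lst : l.getLast? = some v

section basics
variable {V : Type*} {G : SimpleGraph V}

theorem LP.ne_nil {u v : V} {l : List V} (h : LP G u v l) : l ≠ [] := by
  rintro rfl
  simpa using h.hd

theorem LP.append {u v u' v' : V} {l l' : List V} (h : LP G u v l) (h' : LP G u' v' l')
    (ha : G.Adj v u') (hd : ∀ x ∈ l, x ∉ l') : LP G u v' (l ++ l') := by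
  refine ⟨?_, ?_, ?_, ?_⟩
  · rw [List.isChain_append]
    refine ⟨h.chain, h'.chain, ?_⟩
    intro x hx y hy
    rw [h.lst] at hx
    rw [h'.hd] at hy
    simp at hx hy
    subst hx hy
    exact ha
  · rw [List.nodup_append']
    exact ⟨h.nodup, h'.nodup, fun x hx hx' => hd x hx hx'⟩
  · rw [List.head?_append, h.hd]; rfl
  · rw [List.getLast?_append, h'.lst]; rfl

theorem LP.reverse {u v : V} {l : List V} (h : LP G u v l) : LP G v u l.reverse := by
  refine ⟨?_, ?_, ?_, ?_⟩
  · rw [List.isChain_reverse]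
    exact h.chain.imp (fun a b hab => hab.symm)
  · exact List.nodup_reverse.2 h.nodup
  · rw [List.head?_reverse, h.lst]
  · rw [List.getLast?_reverse, h.hd]

theorem LP.single (u : V) : LP G u u [u] := ⟨by simp, by simp, rfl, rfl⟩

theorem LP.take {u v : V} {l : List V} (h : LP G u v l) (i : ℕ) (hi : i < l.length) :
    LP G u l[i] (l.take (i + 1)) := by
  refine ⟨h.chain.take _, h.nodup.sublist (List.take_sublist _ _), ?_, ?_⟩
  · rw [← h.hd]
    simp [List.head?_take]
  · rw [List.getLast?_take]
    simp [hi]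

theorem LP.drop {u v : V} {l : List V} (h : LP G u v l) (i : ℕ) (hi : i < l.length) :
    LP G l[i] v (l.drop i) := by
  refine ⟨h.chain.drop _, h.nodup.sublist (List.drop_sublist _ _), ?_, ?_⟩
  · simp [hi]
  · rw [List.getLast?_drop, if_neg (by omega), h.lst]

theorem LP.cycle {u v : V} {l : List V} (h : LP G u v l) (h3 : 3 ≤ l.length) (ha : G.Adj v u) :
    hasCycleOfOrder G l.length := by
  obtain ⟨a, b, c, l, rfl⟩ : ∃ a b c l', l = a :: b :: c :: l' := by
    match l, h3 with
    | a :: b :: c :: l', _ => exact ⟨a, b, c, l', rfl⟩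
  have hu : a = u := by simpa using h.hd
  subst hu
  set L := a :: b :: c :: l with hL
  have hne : L ≠ [] := by simp [hL]
  have hv : L.getLast hne = v := by
    have := h.lst
    rw [List.getLast?_eq_some_getLast hne] at this
    simpa using this
  let w := Walk.ofSupport L hne h.chain
  have hw : w.support = L := Walk.support_ofSupport hne h.chain
  have hpath : w.IsPath := by
    rw [Walk.isPath_def, hw]; exact h.nodup
  have ha' : G.Adj (L.getLast hne) (L.head hne) := by
    rw [hv]; exact ha
  refine ⟨_, Walk.cons ha' w, ?_, ?_⟩
  · rw [Walk.cons_isCycle_iff]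
    refine ⟨hpath, ?_⟩
    intro he
    have hlen : w.length = 1 := by
      have := hpath.length_eq_one_of_mem_edges (by rw [Sym2.eq_swap]; exact he)
      exact this
    have := w.length_support
    rw [hw, hlen] at this
    simp [hL] at this
  · have := w.length_support
    rw [hw] at this
    simp [this]

theorem LP.shorten {u v : V} {l : List V} (h : LP G u v l) (i j : ℕ) (hij : i < j)
    (hj : j < l.length) (ha : G.Adj (l[i]'(hij.trans hj)) l[j]) :
    LP G u v (l.take (i + 1) ++ l.drop j) := by
  refine (h.take i (by omega)).append (h.drop j hj) ha ?_
  intro x hx hx'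
  exact List.disjoint_take_drop h.nodup (show i + 1 ≤ j by omega) hx hx'

end basics

/-- A saw with `k` teeth: the triangles `s (2i), s (2i+1), s (2i+2)` for `i < k`. -/
structure Saw {V : Type*} (G : SimpleGraph V) (s : ℕ → V) (k : ℕ) : Prop where
  inj : ∀ x y, x ≤ 2 * k → y ≤ 2 * k → s x = s y → x = y
  a01 : ∀ i, i < k → G.Adj (s (2 * i)) (s (2 * i + 1))
  a12 : ∀ i, i < k → G.Adj (s (2 * i + 1)) (s (2 * i + 2))
  a02 : ∀ i, i < k → G.Adj (s (2 * i)) (s (2 * i + 2))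

section saws
variable {V : Type*} {G : SimpleGraph V}

theorem exists_adj_of_no_indep {r : ℕ} (hα : ¬ hasIndepSetOfSize G r) (f : ℕ → V)
    (hf : ∀ i j, i < j → j < r → f i ≠ f j) : ∃ i j, i < j ∧ j < r ∧ G.Adj (f i) (f j) := by
  classical
  by_contra hcon
  push Not at hcon
  have hinj : ∀ i < r, ∀ j < r, f i = f j → i = j := by
    intro i hi j hj hij
    rcases lt_trichotomy i j with h | h | h
    · exact absurd hij (hf i j h hj)
    · exact h
    · exact absurd hij.symm (hf j i h hi)
  refine hα ⟨(Finset.range r).image f, ?_, ?_⟩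
  · rw [Finset.card_image_of_injOn, Finset.card_range]
    intro i hi j hj hij
    exact hinj i (by simpa using hi) j (by simpa using hj) hij
  · intro x hx y hy hxy hadj
    simp only [Finset.mem_image, Finset.mem_range] at hx hy
    obtain ⟨i, hi, rfl⟩ := hx
    obtain ⟨j, hj, rfl⟩ := hy
    rcases lt_trichotomy i j with h | h | h
    · exact hcon i j h hj hadj
    · exact hxy (by rw [h])
    · exact hcon j i h hi hadj.symm

theorem Saw.adj_succ {s : ℕ → V} {k : ℕ} (h : Saw G s k) (x : ℕ) (hx : x < 2 * k) :
    G.Adj (s x) (s (x + 1)) := by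
  rcases Nat.even_or_odd' x with ⟨i, rfl | rfl⟩
  · exact h.a01 i (by omega)
  · exact h.a12 i (by omega)

/-- Flexible paths along the first `K` teeth. -/
theorem Saw.core {s : ℕ → V} {k : ℕ} (h : Saw G s k) (K : ℕ) (hK : K ≤ k) :
    ∀ c, K ≤ c → c ≤ 2 * K → ∃ l : List V, LP G (s 0) (s (2 * K)) l ∧ l.length = c + 1 ∧
      ∀ x ∈ l, ∃ q ≤ 2 * K, x = s q := by
  induction K with
  | zero =>
    intro c _ hc
    obtain rfl : c = 0 := by omega
    exact ⟨[s 0], LP.single _, rfl, fun x hx => ⟨0, by omega, by simpa using hx⟩⟩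
  | succ K ih =>
    intro c hc1 hc2
    have hfresh : ∀ l : List V, (∀ x ∈ l, ∃ q ≤ 2 * K, x = s q) →
        ∀ y, 2 * K < y → y ≤ 2 * k → s y ∉ l := by
      intro l hl y hy hyk hmem
      obtain ⟨q, hq, hqq⟩ := hl _ hmem
      have := h.inj y q hyk (by omega) hqq
      omega
    by_cases hc : c ≤ 2 * K + 1
    · obtain ⟨l, hl, hlen, hmem⟩ := ih (by omega) (c - 1) (by omega) (by omega)
      refine ⟨l ++ [s (2 * (K + 1))], hl.append (LP.single _) (h.a02 K (by omega)) ?_, ?_, ?_⟩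
      · intro x hx hx'
        rw [List.mem_singleton] at hx'
        subst hx'
        exact hfresh l hmem _ (by omega) (by omega) hx
      · simp [hlen]; omega
      · intro x hx
        rw [List.mem_append, List.mem_singleton] at hx
        rcases hx with hx | hx
        · obtain ⟨q, hq, hh⟩ := hmem x hx
          exact ⟨q, by omega, hh⟩
        · exact ⟨_, le_rfl, hx⟩
    · obtain ⟨l, hl, hlen, hmem⟩ := ih (by omega) (c - 2) (by omega) (by omega)
      have h1 : LP G (s 0) (s (2 * K + 1)) (l ++ [s (2 * K + 1)]) := by
        refine hl.append (LP.single _) (h.a01 K (by omega)) ?_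
        intro x hx hx'
        rw [List.mem_singleton] at hx'
        subst hx'
        exact hfresh l hmem _ (by omega) (by omega) hx
      refine ⟨(l ++ [s (2 * K + 1)]) ++ [s (2 * (K + 1))],
        h1.append (LP.single _) (h.a12 K (by omega)) ?_, ?_, ?_⟩
      · intro x hx hx'
        rw [List.mem_singleton] at hx'
        subst hx'
        rw [List.mem_append, List.mem_singleton] at hx
        rcases hx with hx | hx
        · exact hfresh l hmem _ (by omega) (by omega) hx
        · have := h.inj _ _ (by omega) (by omega) hx
          omega
      · simp [hlen]; omega
      · intro x hx
        rw [List.mem_append, List.mem_append, List.mem_singleton, List.mem_singleton] at hx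
        rcases hx with (hx | hx) | hx
        · obtain ⟨q, hq, hh⟩ := hmem x hx
          exact ⟨q, by omega, hh⟩
        · exact ⟨_, by omega, hx⟩
        · exact ⟨_, le_rfl, hx⟩

/-- The straight path from position `x` to position `y`. -/
theorem Saw.straight {s : ℕ → V} {k : ℕ} (h : Saw G s k) (x n : ℕ) (hn : x + n ≤ 2 * k) :
    ∃ l : List V, LP G (s x) (s (x + n)) l ∧ l.length = n + 1 ∧
      ∀ z ∈ l, ∃ q, x ≤ q ∧ q ≤ x + n ∧ z = s q := by
  induction n with
  | zero =>
    exact ⟨[s x], LP.single _, rfl, fun z hz => ⟨x, le_rfl, le_rfl, by simpa using hz⟩⟩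
  | succ n ih =>
    obtain ⟨l, hl, hlen, hmem⟩ := ih (by omega)
    refine ⟨l ++ [s (x + (n + 1))], hl.append (LP.single _) (h.adj_succ _ (by omega)) ?_, ?_, ?_⟩
    · intro z hz hz'
      rw [List.mem_singleton] at hz'
      obtain ⟨q, h1, h2, rfl⟩ := hmem z hz
      have := h.inj _ _ (by omega) (by omega) hz'
      omega
    · simp [hlen]
    · intro z hz
      rw [List.mem_append, List.mem_singleton] at hz
      rcases hz with hz | hz
      · obtain ⟨q, h1, h2, h3⟩ := hmem z hz
        exact ⟨q, h1, by omega, h3⟩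
      · exact ⟨_, by omega, le_rfl, hz⟩

/-- A path with at least `2r - 1` vertices can be shortened slightly. -/
theorem LP.exists_shorter {r : ℕ} (hr : 1 ≤ r) (hα : ¬ hasIndepSetOfSize G r) {u v : V}
    {l : List V} (h : LP G u v l) (hl : 2 * r ≤ l.length + 1) :
    ∃ l' : List V, LP G u v l' ∧ l'.length < l.length ∧ l.length ≤ l'.length + 2 * r ∧
      ∀ x ∈ l', x ∈ l := by
  have hne : ∀ i, i < r → 2 * i < l.length := fun i hi => by omega
  obtain ⟨i, j, hij, hj, hadj⟩ := exists_adj_of_no_indep hα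
    (fun i => l.getD (2 * i) u) (by
      intro i j hij hj heq
      have h1 := hne i (by omega)
      have h2 := hne j hj
      simp only [List.getD_eq_getElem _ _ h1, List.getD_eq_getElem _ _ h2] at heq
      have := (h.nodup.getElem_inj_iff).1 heq
      omega)
  have h1 := hne i (by omega)
  have h2 := hne j hj
  simp only [List.getD_eq_getElem _ _ h1, List.getD_eq_getElem _ _ h2] at hadj
  refine ⟨_, h.shorten (2 * i) (2 * j) (by omega) h2 hadj, ?_, ?_, ?_⟩
  · simp; omega
  · simp; omega
  · intro x hx
    rw [List.mem_append] at hx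
    rcases hx with hx | hx
    · exact List.mem_of_mem_take hx
    · exact List.mem_of_mem_drop hx

theorem Saw.reach {r p : ℕ} (hr : 1 ≤ r) (hp : 4 * r + 2 ≤ p) (hα : ¬ hasIndepSetOfSize G r)
    (hC : ¬ hasCycleOfOrder G p) {s : ℕ → V} {k : ℕ} (h : Saw G s k) (q : ℕ) (hq : q ≤ 2 * k)
    (ha : G.Adj (s 0) (s q)) : q + 2 ≤ p := by
  classical
  by_contra hcon
  have hex : ∃ n, ∃ l : List V, LP G (s (4 * r + 1)) (s q) l ∧ l.length = n ∧
      p ≤ n + 4 * r + 1 ∧ ∀ z ∈ l, ∃ x, 4 * r + 1 ≤ x ∧ x ≤ q ∧ z = s x := by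
    obtain ⟨l, h1, h2, h3⟩ := h.straight (4 * r + 1) (q - (4 * r + 1)) (by omega)
    rw [show 4 * r + 1 + (q - (4 * r + 1)) = q by omega] at h1
    refine ⟨_, l, h1, h2, by omega, ?_⟩
    intro z hz
    obtain ⟨x, hx1, hx2, hx3⟩ := h3 z hz
    exact ⟨x, hx1, by omega, hx3⟩
  obtain ⟨l, hl, hlen, hpl, hmem⟩ := Nat.find_spec hex
  set n := Nat.find hex with hn
  by_cases hsmall : n + 2 * r + 1 ≤ p
  · obtain ⟨c, hc, hclen, hcm⟩ := h.core (2 * r) (by omega) (p - n - 1) (by omega) (by omega)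
    have hcyc := (hc.append hl (by
      have := h.adj_succ (2 * (2 * r)) (by omega)
      rwa [show 2 * (2 * r) + 1 = 4 * r + 1 by omega] at this) (by
      intro x hx hx'
      obtain ⟨a, ha1, rfl⟩ := hcm x hx
      obtain ⟨b, hb1, hb2, hb3⟩ := hmem _ hx'
      have := h.inj _ _ (by omega) (by omega) hb3
      omega)).cycle (by rw [List.length_append, hclen]; omega) ha.symm
    rw [List.length_append, hclen, hlen] at hcyc
    apply hC
    have hnpos : 1 ≤ n := by
      rw [← hlen]
      exact List.length_pos_of_ne_nil hl.ne_nil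
    convert hcyc using 1
    omega
  · obtain ⟨l', h1, h2, h3, h4⟩ := hl.exists_shorter hr hα (by omega)
    exact Nat.find_min hex (m := l'.length) (by omega)
      ⟨l', h1, rfl, by omega, fun z hz => hmem z (h4 z hz)⟩

end saws

section augment
variable {V : Type*} {G : SimpleGraph V}

theorem LP.rewire {a f u v : V} {l mid : List V} (h : LP G a f l) (hm : LP G u v mid) (i j : ℕ)
    (hij : i < j) (hj : j + 1 < l.length) (h1 : G.Adj (l[i]'(by omega)) u)
    (h2 : G.Adj v (l[j]'(by omega))) (h3 : G.Adj (l[i + 1]'(by omega)) l[j + 1])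
    (hdis : ∀ x ∈ mid, x ∉ l) :
    ∃ l', LP G a f l' ∧ l'.length = l.length + mid.length ∧ ∀ x, x ∈ l' ↔ x ∈ l ∨ x ∈ mid := by
  have hA := h.take i (by omega)
  have hC := h.drop (j + 1) hj
  have hM0 := h.take j (by omega)
  have hM := (hM0.drop (i + 1) (by simp; omega)).reverse
  rw [List.getElem_take] at hM
  set A := l.take (i + 1) with hAd
  set C := l.drop (j + 1) with hCd
  set M := (l.take (j + 1)).drop (i + 1) with hMd
  have hl : l = A ++ (M ++ C) := by
    have e1 : M = (l.drop (i + 1)).take (j - i) := by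
      rw [hMd, List.drop_take]
      congr 1
      omega
    have e2 : C = (l.drop (i + 1)).drop (j - i) := by
      rw [hCd, List.drop_drop]
      congr 1
      omega
    rw [e1, e2, List.take_append_drop, hAd, List.take_append_drop]
  have hnd := h.nodup
  rw [hl, List.nodup_append', List.nodup_append'] at hnd
  obtain ⟨-, ⟨-, -, hMC⟩, hAMC⟩ := hnd
  have hmem : ∀ x, x ∈ l ↔ x ∈ A ∨ x ∈ M ∨ x ∈ C := by
    intro x
    conv_lhs => rw [hl]
    simp
  have s1 := hA.append hm h1 (by
    intro x hx hx'
    exact hdis x hx' ((hmem x).2 (Or.inl hx)))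
  have s2 := s1.append hM h2 (by
    intro x hx hx'
    rw [List.mem_reverse] at hx'
    rw [List.mem_append] at hx
    rcases hx with hx | hx
    · exact hAMC hx (List.mem_append.2 (Or.inl hx'))
    · exact hdis x hx ((hmem x).2 (Or.inr (Or.inl hx'))))
  have s3 := s2.append hC h3 (by
    intro x hx hx'
    rw [List.mem_append, List.mem_append, List.mem_reverse] at hx
    rcases hx with (hx | hx) | hx
    · exact hAMC hx (List.mem_append.2 (Or.inr hx'))
    · exact hdis x hx ((hmem x).2 (Or.inr (Or.inr hx')))
    · exact hMC hx hx')
  refine ⟨_, s3, ?_, ?_⟩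
  · conv_rhs => rw [hl]
    simp only [List.length_append, List.length_reverse]
    omega
  · intro x
    rw [hmem x]
    simp only [List.mem_append, List.mem_reverse]
    tauto

theorem exists_adj_finset {r : ℕ} (hα : ¬ hasIndepSetOfSize G r) (I : Finset ℕ) (hI : r ≤ I.card)
    (g : ℕ → V) (hg : ∀ i ∈ I, ∀ j ∈ I, i < j → g i ≠ g j) :
    ∃ i ∈ I, ∃ j ∈ I, i < j ∧ G.Adj (g i) (g j) := by
  let φ := I.orderEmbOfFin rfl
  let ψ : ℕ → ℕ := fun n => if h : n < I.card then φ ⟨n, h⟩ else 0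
  have hψ : ∀ n, n < r → ψ n ∈ I := by
    intro n hn
    have : n < I.card := by omega
    simp only [ψ, this, dif_pos]
    exact Finset.orderEmbOfFin_mem _ _ _
  have hψ2 : ∀ i j, i < j → j < r → ψ i < ψ j := by
    intro i j hij hj
    have h1 : i < I.card := by omega
    have h2 : j < I.card := by omega
    simp only [ψ, h1, h2, dif_pos]
    exact φ.strictMono (by simpa using hij)
  obtain ⟨i, j, hij, hj, ha⟩ := exists_adj_of_no_indep hα (fun n => g (ψ n)) (by
    intro i j hij hj
    exact hg _ (hψ i (by omega)) _ (hψ j hj) (hψ2 i j hij hj))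
  exact ⟨_, hψ i (by omega), _, hψ j hj, hψ2 i j hij hj, ha⟩

open Classical in
theorem augment_step [Fintype V] {r : ℕ} (hα : ¬ hasIndepSetOfSize G r) (W Z : Finset V)
    (hWZ : W ⊆ Z) (hcl : ∀ x ∈ W, ∀ y ∈ W, x ≠ y → G.Adj x y) (e t : ℕ) (a f : V)
    (hout : ∀ w ∈ W, e ≤ ((Finset.univ.filter (fun z => G.Adj w z)) \ Z).card)
    (hW : e + r ≤ W.card) (hte : t < e) (l : List V) (hl : LP G a f l)
    (hlZ : ∀ x ∈ l, x ∈ W ∨ x ∉ Z) (hWl : ∀ w ∈ W, w ∈ l) (hlen : l.length = W.card + t) :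
    ∃ t' l', (t' = t + 1 ∨ t' = t + 2) ∧ LP G a f l' ∧ (∀ x ∈ l', x ∈ W ∨ x ∉ Z) ∧
      (∀ w ∈ W, w ∈ l') ∧ l'.length = W.card + t' := by
  have hcardl : l.toFinset.card = W.card + t := by
    rw [List.toFinset_card_of_nodup hl.nodup, hlen]
  have hWsub : W ⊆ l.toFinset := fun w hw => List.mem_toFinset.2 (hWl w hw)
  have hdiff : (l.toFinset \ W).card = t := by
    rw [Finset.card_sdiff_of_subset hWsub, hcardl]; omega
  have hnb : ∀ w, ∃ o, w ∈ W → (G.Adj w o ∧ o ∉ Z ∧ o ∉ l) := by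
    intro w
    by_cases hw : w ∈ W
    · by_contra hcon
      push Not at hcon
      have : ((Finset.univ.filter (fun z => G.Adj w z)) \ Z) ⊆ l.toFinset \ W := by
        intro o ho
        simp only [Finset.mem_sdiff, Finset.mem_filter, Finset.mem_univ, true_and] at ho
        rw [Finset.mem_sdiff, List.mem_toFinset]
        exact ⟨(hcon o).2 ho.1 ho.2, fun h => ho.2 (hWZ h)⟩
      have h1 := Finset.card_le_card this
      have h2 := hout w hw
      omega
    · exact ⟨w, fun h => absurd h hw⟩
  choose o ho using hnb
  let I := (Finset.range (l.length - 1)).filter (fun i => l.getD i a ∈ W ∧ l.getD (i + 1) a ∈ W)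
  have hgetD : ∀ i (hi : i < l.length), l.getD i a = l[i] := fun i hi =>
    List.getD_eq_getElem _ _ hi
  have hinjD : ∀ i j, i < l.length → j < l.length → l.getD i a = l.getD j a → i = j := by
    intro i j hi hj hij
    rw [hgetD i hi, hgetD j hj] at hij
    exact (hl.nodup.getElem_inj_iff).1 hij
  have hI : r ≤ I.card := by
    have hc := Finset.card_filter_add_card_filter_not (s := Finset.range (l.length - 1))
      (fun i => l.getD i a ∈ W ∧ l.getD (i + 1) a ∈ W)
    rw [Finset.card_range] at hc
    have hb1 : ((Finset.range (l.length - 1)).filter (fun i => l.getD i a ∉ W)).card ≤ t := by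
      rw [← hdiff]
      apply Finset.card_le_card_of_injOn (fun i => l.getD i a)
      · intro i hi
        simp only [Finset.coe_filter, Finset.mem_range, Set.mem_setOf_eq] at hi
        simp only [Finset.coe_sdiff, Set.mem_diff, Finset.mem_coe, List.mem_toFinset]
        refine ⟨?_, hi.2⟩
        rw [hgetD i (by omega)]
        exact List.getElem_mem _
      · intro i hi j hj hij
        simp only [Finset.coe_filter, Finset.mem_range, Set.mem_setOf_eq] at hi hj
        exact hinjD i j (by omega) (by omega) hij
    have hb2 : ((Finset.range (l.length - 1)).filter
        (fun i => l.getD (i + 1) a ∉ W)).card ≤ t := by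
      rw [← hdiff]
      apply Finset.card_le_card_of_injOn (fun i => l.getD (i + 1) a)
      · intro i hi
        simp only [Finset.coe_filter, Finset.mem_range, Set.mem_setOf_eq] at hi
        simp only [Finset.coe_sdiff, Set.mem_diff, Finset.mem_coe, List.mem_toFinset]
        refine ⟨?_, hi.2⟩
        rw [hgetD (i + 1) (by omega)]
        exact List.getElem_mem _
      · intro i hi j hj hij
        simp only [Finset.coe_filter, Finset.mem_range, Set.mem_setOf_eq] at hi hj
        have := hinjD (i + 1) (j + 1) (by omega) (by omega) hij
        omega
    have hb3 : ((Finset.range (l.length - 1)).filter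
        (fun i => ¬ (l.getD i a ∈ W ∧ l.getD (i + 1) a ∈ W))).card ≤ t + t := by
      refine le_trans (Finset.card_le_card ?_) ((Finset.card_union_le _ _).trans
        (Nat.add_le_add hb1 hb2))
      intro i hi
      simp only [Finset.mem_filter, Finset.mem_union] at hi ⊢
      tauto
    have : I.card = ((Finset.range (l.length - 1)).filter
      (fun i => l.getD i a ∈ W ∧ l.getD (i + 1) a ∈ W)).card := rfl
    omega
  have hImem : ∀ i ∈ I, ∃ hi : i + 1 < l.length, l[i] ∈ W ∧ l[i + 1] ∈ W := by
    intro i hi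
    simp only [I, Finset.mem_filter, Finset.mem_range] at hi
    refine ⟨by omega, ?_⟩
    rw [hgetD i (by omega), hgetD (i + 1) (by omega)] at hi
    exact hi.2
  have fin : ∀ i ∈ I, ∀ j ∈ I, i < j → ∀ u v mid, LP G u v mid → u = o (l.getD i a) →
      v = o (l.getD j a) → (mid.length = 1 ∨ mid.length = 2) →
      (∀ x ∈ mid, x = u ∨ x = v) → ∃ t' l', (t' = t + 1 ∨ t' = t + 2) ∧ LP G a f l' ∧
      (∀ x ∈ l', x ∈ W ∨ x ∉ Z) ∧ (∀ w ∈ W, w ∈ l') ∧ l'.length = W.card + t' := by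
    intro i hi j hj hij u v mid hm hu hv hml hmm
    obtain ⟨hi1, hi2, hi3⟩ := hImem i hi
    obtain ⟨hj1, hj2, hj3⟩ := hImem j hj
    rw [hgetD i (by omega)] at hu
    rw [hgetD j (by omega)] at hv
    have oi := ho _ hi2
    have oj := ho _ hj2
    rw [← hu] at oi
    rw [← hv] at oj
    obtain ⟨l', h1, h2, h3⟩ := hl.rewire hm i j hij hj1 oi.1 oj.1.symm
      (hcl _ hi3 _ hj3 (by
        intro h
        have := (hl.nodup.getElem_inj_iff).1 h
        omega))
      (by
        intro x hx
        rcases hmm x hx with rfl | rfl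
        · exact oi.2.2
        · exact oj.2.2)
    refine ⟨t + mid.length, l', by omega, h1, ?_, ?_, by omega⟩
    · intro x hx
      rcases (h3 x).1 hx with hx | hx
      · exact hlZ x hx
      · right
        rcases hmm x hx with rfl | rfl
        · exact oi.2.1
        · exact oj.2.1
    · intro w hw
      exact (h3 w).2 (Or.inl (hWl w hw))
  by_cases hinj : ∀ i ∈ I, ∀ j ∈ I, i < j → o (l.getD i a) ≠ o (l.getD j a)
  · obtain ⟨i, hi, j, hj, hij, ha⟩ := exists_adj_finset hα I hI (fun i => o (l.getD i a)) hinj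
    refine fin i hi j hj hij _ _ [o (l.getD i a), o (l.getD j a)] ?_ rfl rfl (Or.inr rfl) ?_
    · exact ⟨by simpa using ha, by simpa using ha.ne, rfl, rfl⟩
    · intro x hx
      simpa using hx
  · push Not at hinj
    obtain ⟨i, hi, j, hj, hij, heq⟩ := hinj
    refine fin i hi j hj hij _ _ [o (l.getD i a)] (LP.single _) rfl heq (Or.inl rfl) ?_
    intro x hx
    left
    simpa using hx

theorem clique_path (W : Finset V) (hcl : ∀ x ∈ W, ∀ y ∈ W, x ≠ y → G.Adj x y) (a f : V)
    (ha : a ∈ W) (hf : f ∈ W) (haf : a ≠ f) :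
    ∃ l, LP G a f l ∧ (∀ x, x ∈ l ↔ x ∈ W) ∧ l.length = W.card := by
  classical
  set l := a :: (((W.erase a).erase f).toList ++ [f]) with hl
  have hmem : ∀ x, x ∈ l ↔ x ∈ W := by
    intro x
    simp only [hl, List.mem_cons, List.mem_append, Finset.mem_toList, Finset.mem_erase,
      List.not_mem_nil, or_false]
    constructor
    · rintro (rfl | ⟨-, -, h⟩ | rfl) <;> assumption
    · intro h
      by_cases h1 : x = a
      · exact Or.inl h1
      · by_cases h2 : x = f
        · exact Or.inr (Or.inr h2)
        · exact Or.inr (Or.inl ⟨h2, h1, h⟩)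
  have hnd : l.Nodup := by
    rw [hl, List.nodup_cons, List.nodup_append']
    refine ⟨?_, Finset.nodup_toList _, by simp, ?_⟩
    · simp [haf]
    · intro x hx hx'
      simp at hx hx'
      exact hx.1 hx'
  refine ⟨l, ⟨?_, hnd, rfl, ?_⟩, hmem, ?_⟩
  · apply List.Pairwise.isChain
    refine List.Pairwise.imp_of_mem ?_ hnd
    intro x y hx hy hxy
    exact hcl x ((hmem x).1 hx) y ((hmem y).1 hy) hxy
  · show ((a :: ((W.erase a).erase f).toList) ++ [f]).getLast? = some f
    rw [List.getLast?_append]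
    rfl
  · rw [← List.toFinset_card_of_nodup hnd]
    congr 1
    ext x
    rw [List.mem_toFinset, hmem]

open Classical in
theorem augment [Fintype V] {r : ℕ} (hr : 2 ≤ r) (hα : ¬ hasIndepSetOfSize G r) (W Z : Finset V)
    (hWZ : W ⊆ Z) (hcl : ∀ x ∈ W, ∀ y ∈ W, x ≠ y → G.Adj x y) (e : ℕ) (a f : V)
    (ha : a ∈ W) (hf : f ∈ W) (haf : a ≠ f) (he : 1 ≤ e)
    (hout : ∀ w ∈ W, e ≤ ((Finset.univ.filter (fun z => G.Adj w z)) \ Z).card)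
    (hW : e + r + 1 ≤ W.card) :
    ∃ l, LP G a f l ∧ (∀ x ∈ l, x ∈ W ∨ x ∉ Z) ∧ l.length = W.card + e := by
  obtain ⟨w0, hw0, h0a, h0f⟩ : ∃ w ∈ W, w ≠ a ∧ w ≠ f := by
    have : 0 < ((W.erase a).erase f).card := by
      rw [Finset.card_erase_of_mem (by simp [haf.symm, hf]), Finset.card_erase_of_mem ha]
      omega
    obtain ⟨w, hw⟩ := Finset.card_pos.1 this
    simp only [Finset.mem_erase] at hw
    exact ⟨w, hw.2.2, hw.2.1, hw.1⟩
  set W' := W.erase w0 with hW'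
  have hW'c : W'.card + 1 = W.card := Finset.card_erase_add_one hw0
  have hsub : W' ⊆ W := Finset.erase_subset _ _
  have key : ∀ n, n ≤ e → ∃ t l, (n ≤ t ∧ t ≤ e + 1) ∧ LP G a f l ∧
      (∀ x ∈ l, x ∈ W' ∨ x ∉ Z) ∧ (∀ w ∈ W', w ∈ l) ∧ l.length = W'.card + t := by
    intro n
    induction n with
    | zero =>
      intro _
      obtain ⟨l, h1, h2, h3⟩ := clique_path W'
        (fun x hx y hy => hcl x (hsub hx) y (hsub hy)) a f
        (Finset.mem_erase.2 ⟨h0a.symm, ha⟩) (Finset.mem_erase.2 ⟨h0f.symm, hf⟩) haf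
      exact ⟨0, l, by omega, h1, fun x hx => Or.inl ((h2 x).1 hx), fun w hw => (h2 w).2 hw, by omega⟩
    | succ n ih =>
      intro hn
      obtain ⟨t, l, ht, h1, h2, h3, h4⟩ := ih (by omega)
      by_cases hte : n + 1 ≤ t
      · exact ⟨t, l, ⟨hte, ht.2⟩, h1, h2, h3, h4⟩
      · obtain ⟨t', l', ht', g1, g2, g3, g4⟩ := augment_step hα W' Z (hsub.trans hWZ)
          (fun x hx y hy => hcl x (hsub hx) y (hsub hy)) e t a f
          (fun w hw => hout w (hsub hw)) (by omega) (by omega) l h1 h2 h3 h4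
        exact ⟨t', l', by omega, g1, g2, g3, g4⟩
  obtain ⟨t, l, ht, h1, h2, h3, h4⟩ := key e le_rfl
  have hlW : ∀ x ∈ l, x ∈ W ∨ x ∉ Z := fun x hx => (h2 x hx).imp (fun h => hsub h) id
  by_cases hte : t = e
  · -- insert `w0` somewhere
    have hw0l : w0 ∉ l := by
      intro h
      rcases h2 w0 h with h | h
      · simp [hW'] at h
      · exact h (hWZ hw0)
    -- find a free junction
    have hex : ∃ i, ∃ hi : i + 1 < l.length, l[i] ∈ W' ∧ l[i + 1] ∈ W' := by
      by_contra hcon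
      push Not at hcon
      have hcardl : l.toFinset.card = W'.card + t := by
        rw [List.toFinset_card_of_nodup h1.nodup, h4]
      have hdiff : (l.toFinset \ W').card = t := by
        rw [Finset.card_sdiff_of_subset (fun w hw => List.mem_toFinset.2 (h3 w hw)), hcardl]
        omega
      -- each clique vertex except the last is followed by an outer vertex
      have : ((Finset.range (l.length - 1)).filter (fun i => l.getD i a ∈ W')).card ≤ t := by
        rw [← hdiff]
        apply Finset.card_le_card_of_injOn (fun i => l.getD (i + 1) a)
        · intro i hi
          simp only [Finset.coe_filter, Finset.mem_range, Set.mem_setOf_eq] at hi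
          have hi1 : i + 1 < l.length := by omega
          rw [List.getD_eq_getElem _ _ (by omega)] at hi
          simp only [Finset.coe_sdiff, Set.mem_diff, Finset.mem_coe, List.mem_toFinset]
          rw [List.getD_eq_getElem _ _ hi1]
          exact ⟨List.getElem_mem _, hcon i hi1 hi.2⟩
        · intro i hi j hj hij
          simp only [Finset.coe_filter, Finset.mem_range, Set.mem_setOf_eq] at hi hj
          simp only at hij
          rw [List.getD_eq_getElem _ _ (by omega), List.getD_eq_getElem _ _ (by omega)] at hij
          have := (h1.nodup.getElem_inj_iff).1 hij
          omega
      have h5 : (W'.erase f).card ≤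
          ((Finset.range (l.length - 1)).filter (fun i => l.getD i a ∈ W')).card := by
        apply Finset.card_le_card_of_surjOn (fun i => l.getD i a)
        intro w hw
        simp only [Finset.coe_erase, Set.mem_diff, Finset.mem_coe, Set.mem_singleton_iff] at hw
        obtain ⟨i, hi, hiw⟩ := List.mem_iff_getElem.1 (h3 w hw.1)
        refine ⟨i, ?_, ?_⟩
        · simp only [Finset.coe_filter, Finset.mem_range, Set.mem_setOf_eq]
          rw [List.getD_eq_getElem _ _ hi, hiw]
          refine ⟨?_, hw.1⟩
          by_contra hlast
          apply hw.2
          have := h1.lst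
          rw [List.getLast?_eq_getElem?, show l.length - 1 = i by omega,
            List.getElem?_eq_getElem hi] at this
          rw [← hiw]
          simpa using this
        · simp only
          rw [List.getD_eq_getElem _ _ hi, hiw]
      have h6 : W'.card - 1 ≤ (W'.erase f).card := Finset.pred_card_le_card_erase
      omega
    obtain ⟨i, hi, hi1, hi2⟩ := hex
    have hA := h1.take i (by omega)
    have hB := h1.drop (i + 1) hi
    have hne : ∀ x ∈ W', x ≠ w0 := fun x hx => (Finset.mem_erase.1 hx).1
    have s1 := hA.append (LP.single w0) (hcl _ (hsub hi1) _ hw0 (hne _ hi1)) (by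
      intro x hx hx'
      rw [List.mem_singleton] at hx'
      subst hx'
      exact hw0l (List.mem_of_mem_take hx))
    have s2 := s1.append hB (hcl _ hw0 _ (hsub hi2) (hne _ hi2).symm) (by
      intro x hx hx'
      rw [List.mem_append, List.mem_singleton] at hx
      rcases hx with hx | hx
      · exact List.disjoint_take_drop h1.nodup le_rfl hx hx'
      · subst hx
        exact hw0l (List.mem_of_mem_drop hx'))
    refine ⟨_, s2, ?_, ?_⟩
    · intro x hx
      rw [List.mem_append, List.mem_append, List.mem_singleton] at hx
      rcases hx with (hx | hx) | hx
      · exact hlW x (List.mem_of_mem_take hx)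
      · subst hx; exact Or.inl hw0
      · exact hlW x (List.mem_of_mem_drop hx)
    · simp; omega
  · exact ⟨l, h1, hlW, by omega⟩

end augment

section core
variable {V : Type*} {G : SimpleGraph V}

theorem Saw.rot {s : ℕ → V} {k : ℕ} (h : Saw G s k) (j : ℕ) (hj : j < k)
    (h1 : G.Adj (s 0) (s (2 * j + 1))) (h2 : G.Adj (s 0) (s (2 * j + 2))) :
    Saw G (fun x => if x ≤ 2 * j then s (2 * j - x) else s x) k := by
  constructor
  · intro x y hx hy hxy
    split_ifs at hxy with c1 c2 c2
    · have := h.inj _ _ (by omega) (by omega) hxy; omega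
    · have := h.inj _ _ (by omega) (by omega) hxy; omega
    · have := h.inj _ _ (by omega) (by omega) hxy; omega
    · exact h.inj _ _ (by omega) (by omega) hxy
  · intro i hi
    rcases lt_trichotomy i j with c | c | c
    · rw [if_pos (by omega), if_pos (by omega)]
      have := (h.a12 (j - i - 1) (by omega)).symm
      rw [show 2 * j - 2 * i = 2 * (j - i - 1) + 2 by omega,
        show 2 * j - (2 * i + 1) = 2 * (j - i - 1) + 1 by omega]
      exact this
    · subst c
      rw [if_pos (by omega), if_neg (by omega), Nat.sub_self]
      exact h1
    · rw [if_neg (by omega), if_neg (by omega)]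
      exact h.a01 i hi
  · intro i hi
    rcases lt_trichotomy i j with c | c | c
    · rw [if_pos (by omega), if_pos (by omega)]
      have := (h.a01 (j - i - 1) (by omega)).symm
      rw [show 2 * j - (2 * i + 2) = 2 * (j - i - 1) by omega,
        show 2 * j - (2 * i + 1) = 2 * (j - i - 1) + 1 by omega]
      exact this
    · subst c
      rw [if_neg (by omega), if_neg (by omega)]
      exact h.a12 i hi
    · rw [if_neg (by omega), if_neg (by omega)]
      exact h.a12 i hi
  · intro i hi
    rcases lt_trichotomy i j with c | c | c
    · rw [if_pos (by omega), if_pos (by omega)]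
      have := (h.a02 (j - i - 1) (by omega)).symm
      rw [show 2 * j - (2 * i + 2) = 2 * (j - i - 1) by omega,
        show 2 * j - (2 * i) = 2 * (j - i - 1) + 2 by omega]
      exact this
    · subst c
      rw [if_pos (by omega), if_neg (by omega), Nat.sub_self]
      exact h2
    · rw [if_neg (by omega), if_neg (by omega)]
      exact h.a02 i hi

theorem Saw.swap {s : ℕ → V} {k : ℕ} (h : Saw G s k) (hk : 0 < k) :
    Saw G (fun x => if x = 0 then s 1 else if x = 1 then s 0 else s x) k := by
  constructor
  · intro x y hx hy hxy
    split_ifs at hxy <;> have := h.inj _ _ (by omega) (by omega) hxy <;> omega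
  · intro i hi
    rcases Nat.eq_zero_or_pos i with c | c
    · subst c
      simpa using (h.a01 0 hk).symm
    · beta_reduce
      rw [if_neg (by omega), if_neg (by omega), if_neg (by omega), if_neg (by omega)]
      exact h.a01 i hi
  · intro i hi
    rcases Nat.eq_zero_or_pos i with c | c
    · subst c
      simpa using (h.a02 0 hk)
    · beta_reduce
      rw [if_neg (by omega), if_neg (by omega), if_neg (by omega), if_neg (by omega)]
      exact h.a12 i hi
  · intro i hi
    rcases Nat.eq_zero_or_pos i with c | c
    · subst c
      simpa using (h.a12 0 hk)
    · beta_reduce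
      rw [if_neg (by omega), if_neg (by omega), if_neg (by omega), if_neg (by omega)]
      exact h.a02 i hi

theorem Saw.extend {s : ℕ → V} {k : ℕ} (h : Saw G s k) (x y : V)
    (hx : ∀ q, q ≤ 2 * k → s q ≠ x) (hy : ∀ q, q ≤ 2 * k → s q ≠ y)
    (hsx : G.Adj (s 0) x) (hsy : G.Adj (s 0) y) (hxy : G.Adj x y) :
    Saw G (fun n => if n = 0 then x else if n = 1 then y else s (n - 2)) (k + 1) := by
  constructor
  · intro u v hu hv huv
    split_ifs at huv with c1 c2 c3 c4 c5 c6 c7 c8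
    · omega
    · exact absurd huv hxy.ne
    · exact absurd huv.symm (hx _ (by omega))
    · exact absurd huv.symm hxy.ne
    · omega
    · exact absurd huv.symm (hy _ (by omega))
    · exact absurd huv (hx _ (by omega))
    · exact absurd huv (hy _ (by omega))
    · have := h.inj _ _ (by omega) (by omega) huv
      omega
  · intro i hi
    rcases Nat.eq_zero_or_pos i with c | c
    · subst c
      simpa using hxy
    · beta_reduce
      rw [if_neg (by omega), if_neg (by omega), if_neg (by omega), if_neg (by omega)]
      have := h.a01 (i - 1) (by omega)
      rw [show 2 * i - 2 = 2 * (i - 1) by omega, show 2 * i + 1 - 2 = 2 * (i - 1) + 1 by omega]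
      exact this
  · intro i hi
    rcases Nat.eq_zero_or_pos i with c | c
    · subst c
      simpa using hsy.symm
    · beta_reduce
      rw [if_neg (by omega), if_neg (by omega), if_neg (by omega), if_neg (by omega)]
      have := h.a12 (i - 1) (by omega)
      rw [show 2 * i + 2 - 2 = 2 * (i - 1) + 2 by omega,
        show 2 * i + 1 - 2 = 2 * (i - 1) + 1 by omega]
      exact this
  · intro i hi
    rcases Nat.eq_zero_or_pos i with c | c
    · subst c
      simpa using hsx.symm
    · beta_reduce
      rw [if_neg (by omega), if_neg (by omega), if_neg (by omega), if_neg (by omega)]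
      have := h.a02 (i - 1) (by omega)
      rw [show 2 * i - 2 = 2 * (i - 1) by omega, show 2 * i + 2 - 2 = 2 * (i - 1) + 2 by omega]
      exact this

/-- `w` is the end of some saw with the same vertices (and the same initial vertices) as `s`. -/
def IsEnd (G : SimpleGraph V) (s : ℕ → V) (k p : ℕ) (w : V) : Prop :=
  ∃ s' : ℕ → V, Saw G s' k ∧ s' 0 = w ∧ (∀ q, q ≤ 2 * k → ∃ q', q' ≤ 2 * k ∧ s' q' = s q) ∧
    ∀ q, q ≤ 2 * k → ∃ q', q' ≤ 2 * k ∧ s' q = s q' ∧ (q + 2 ≤ p → q' + 2 ≤ p)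

theorem Saw.isEnd_zero {s : ℕ → V} {k : ℕ} (h : Saw G s k) (p : ℕ) : IsEnd G s k p (s 0) :=
  ⟨s, h, rfl, fun q hq => ⟨q, hq, rfl⟩, fun q hq => ⟨q, hq, rfl, id⟩⟩

theorem Saw.isEnd_rot {s : ℕ → V} {k p : ℕ} (h : Saw G s k) (j : ℕ) (hj : j < k)
    (hjp : 2 * j + 4 ≤ p)
    (h1 : G.Adj (s 0) (s (2 * j + 1))) (h2 : G.Adj (s 0) (s (2 * j + 2))) :
    IsEnd G s k p (s (2 * j)) := by
  refine ⟨_, h.rot j hj h1 h2, by simp, ?_, ?_⟩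
  · intro q hq
    by_cases c : q ≤ 2 * j
    · refine ⟨2 * j - q, by omega, ?_⟩
      rw [if_pos (by omega), Nat.sub_sub_self c]
    · refine ⟨q, by omega, ?_⟩
      rw [if_neg c]
  · intro q hq
    by_cases c : q ≤ 2 * j
    · refine ⟨2 * j - q, by omega, ?_, by omega⟩
      rw [if_pos (by omega)]
    · refine ⟨q, by omega, ?_, id⟩
      rw [if_neg c]

theorem IsEnd.trans {s s' : ℕ → V} {k p : ℕ} {w : V} (h : IsEnd G s' k p w)
    (h1 : ∀ q, q ≤ 2 * k → ∃ q', q' ≤ 2 * k ∧ s' q' = s q)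
    (h2 : ∀ q, q ≤ 2 * k → ∃ q', q' ≤ 2 * k ∧ s' q = s q' ∧ (q + 2 ≤ p → q' + 2 ≤ p)) :
    IsEnd G s k p w := by
  obtain ⟨t, a, b, c, d⟩ := h
  refine ⟨t, a, b, ?_, ?_⟩
  · intro q hq
    obtain ⟨q', hq', e⟩ := h1 q hq
    obtain ⟨q'', hq'', e'⟩ := c q' hq'
    exact ⟨q'', hq'', e'.trans e⟩
  · intro q hq
    obtain ⟨q', hq', e, f⟩ := d q hq
    obtain ⟨q'', hq'', e', f'⟩ := h2 q' hq'
    exact ⟨q'', hq'', e.trans e', fun g => f' (f g)⟩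

theorem Saw.isEnd_one {s : ℕ → V} {k p : ℕ} (h : Saw G s k) (hk : 0 < k) (hp : 3 ≤ p) :
    IsEnd G s k p (s 1) := by
  refine ⟨_, h.swap hk, by simp, ?_, ?_⟩
  · intro q hq
    by_cases c : q = 0
    · exact ⟨1, by omega, by simp [c]⟩
    · by_cases c' : q = 1
      · exact ⟨0, by omega, by simp [c']⟩
      · exact ⟨q, hq, by simp [c, c']⟩
  · intro q hq
    by_cases c : q = 0
    · exact ⟨1, by omega, by simp [c], by omega⟩
    · by_cases c' : q = 1
      · exact ⟨0, by omega, by simp [c'], by omega⟩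
      · exact ⟨q, hq, by simp [c, c'], id⟩

theorem Saw.isEnd_rot_one {s : ℕ → V} {k p : ℕ} (h : Saw G s k) (j : ℕ) (hj : j < k)
    (hj1 : 1 ≤ j) (hjp : 2 * j + 4 ≤ p)
    (h1 : G.Adj (s 0) (s (2 * j + 1))) (h2 : G.Adj (s 0) (s (2 * j + 2))) :
    IsEnd G s k p (s (2 * j - 1)) := by
  have := (h.rot j hj h1 h2).isEnd_one (p := p) (by omega) (by omega)
  rw [if_pos (by omega)] at this
  refine this.trans ?_ ?_
  · intro q hq
    by_cases c : q ≤ 2 * j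
    · refine ⟨2 * j - q, by omega, ?_⟩
      rw [if_pos (by omega), Nat.sub_sub_self c]
    · refine ⟨q, by omega, ?_⟩
      rw [if_neg c]
  · intro q hq
    by_cases c : q ≤ 2 * j
    · refine ⟨2 * j - q, by omega, ?_, by omega⟩
      rw [if_pos (by omega)]
    · refine ⟨q, by omega, ?_, id⟩
      rw [if_neg c]

theorem card_lt_of_indep {r : ℕ} (hα : ¬ hasIndepSetOfSize G r) (O : Finset V)
    (hO : ∀ x ∈ O, ∀ y ∈ O, x ≠ y → ¬ G.Adj x y) : O.card + 1 ≤ r := by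
  by_contra hcon
  obtain ⟨t, ht, htc⟩ := Finset.exists_subset_card_eq (show r ≤ O.card by omega)
  exact hα ⟨t, htc, fun x hx y hy => hO x (ht hx) y (ht hy)⟩

open Classical in
theorem IsEnd.nbrs [Fintype V] {s : ℕ → V} {k p r : ℕ} (hr : 1 ≤ r) (hp : 4 * r + 2 ≤ p)
    (hα : ¬ hasIndepSetOfSize G r) (hC : ¬ hasCycleOfOrder G p)
    (hmax : ∀ t, ¬ Saw G t (k + 1)) {w : V} (hw : IsEnd G s k p w) :
    ∃ O : Finset V, O.card + 1 ≤ r ∧ (∃ q, q ≤ 2 * k ∧ q + 2 ≤ p ∧ w = s q) ∧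
      ∀ z, G.Adj w z → z ∈ O ∨ ∃ q, q ≤ 2 * k ∧ q + 2 ≤ p ∧ z = s q := by
  obtain ⟨t, ht, rfl, h1, h2⟩ := hw
  refine ⟨Finset.univ.filter (fun z => G.Adj (t 0) z ∧ ∀ q, q ≤ 2 * k → t q ≠ z),
    card_lt_of_indep hα _ ?_, ?_, ?_⟩
  · intro x hx y hy hxy hadj
    simp only [Finset.mem_filter, Finset.mem_univ, true_and] at hx hy
    exact hmax _ (ht.extend x y hx.2 hy.2 hx.1 hy.1 hadj)
  · obtain ⟨q, a, b, c⟩ := h2 0 (by omega)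
    exact ⟨q, a, c (by omega), b⟩
  · intro z hz
    by_cases hq : ∃ q, q ≤ 2 * k ∧ t q = z
    · right
      obtain ⟨q, hq, rfl⟩ := hq
      have := Saw.reach hr hp hα hC ht q hq hz
      obtain ⟨q', a, b, c⟩ := h2 q hq
      exact ⟨q', a, c this, b⟩
    · left
      simp only [Finset.mem_filter, Finset.mem_univ, true_and]
      push Not at hq
      exact ⟨hz, hq⟩

open Classical in
theorem ends_adj [Fintype V] {s : ℕ → V} {k p r : ℕ} (hr : 1 ≤ r) (hp : 4 * r + 2 ≤ p)
    (hα : ¬ hasIndepSetOfSize G r) (hC : ¬ hasCycleOfOrder G p)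
    (hmax : ∀ t, ¬ Saw G t (k + 1))
    (hnon : ∀ a b, a ≠ b → ¬ G.Adj a b →
      2 * p - 1 ≤ (Finset.univ.filter (fun z => z = a ∨ z = b ∨ G.Adj a z ∨ G.Adj b z)).card)
    {w w' : V} (hw : IsEnd G s k p w) (hw' : IsEnd G s k p w') (hne : w ≠ w') : G.Adj w w' := by
  by_contra hcon
  obtain ⟨O, hO, hwT, hN⟩ := hw.nbrs hr hp hα hC hmax
  obtain ⟨O', hO', hwT', hN'⟩ := hw'.nbrs hr hp hα hC hmax
  have hb := hnon w w' hne hcon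
  set T := (Finset.range (p - 1)).image s with hT
  have hTc : T.card ≤ p - 1 := by
    refine Finset.card_image_le.trans ?_
    simp
  have hTm : ∀ z, (∃ q, q ≤ 2 * k ∧ q + 2 ≤ p ∧ z = s q) → z ∈ T := by
    rintro z ⟨q, -, a, rfl⟩
    exact Finset.mem_image_of_mem _ (Finset.mem_range.2 (by omega))
  have hsub : Finset.univ.filter (fun z => z = w ∨ z = w' ∨ G.Adj w z ∨ G.Adj w' z) ⊆
      T ∪ (O ∪ O') := by
    intro z hz
    simp only [Finset.mem_filter, Finset.mem_univ, true_and] at hz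
    simp only [Finset.mem_union]
    rcases hz with rfl | rfl | hz | hz
    · exact Or.inl (hTm _ hwT)
    · exact Or.inl (hTm _ hwT')
    · rcases hN z hz with h | h
      · exact Or.inr (Or.inl h)
      · exact Or.inl (hTm _ h)
    · rcases hN' z hz with h | h
      · exact Or.inr (Or.inr h)
      · exact Or.inl (hTm _ h)
  have h1 := Finset.card_le_card hsub
  have h2 := Finset.card_union_le T (O ∪ O')
  have h3 := Finset.card_union_le O O'
  omega

open Classical in
theorem core_false [Fintype V] [Nonempty V] {p r : ℕ} (hr : 2 ≤ r) (hp : 4 * r + 2 ≤ p)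
    (hα : ¬ hasIndepSetOfSize G r) (hC : ¬ hasCycleOfOrder G p)
    (hdeg : ∀ x, p - 1 ≤ (Finset.univ.filter (fun z => G.Adj x z)).card)
    (hnon : ∀ a b, a ≠ b → ¬ G.Adj a b →
      2 * p - 1 ≤ (Finset.univ.filter (fun z => z = a ∨ z = b ∨ G.Adj a z ∨ G.Adj b z)).card) :
    False := by
  -- a saw with the largest number of teeth
  obtain ⟨k, s, hs, hmax⟩ : ∃ k s, Saw G s k ∧ ∀ t, ¬ Saw G t (k + 1) := by
    by_contra hcon
    push Not at hcon
    have : ∀ k, ∃ s, Saw G s k := by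
      intro k
      induction k with
      | zero =>
        refine ⟨fun _ => Classical.arbitrary V, ?_, ?_, ?_, ?_⟩
        · intro x y hx hy _
          omega
        all_goals intro i hi; omega
      | succ k ih =>
        obtain ⟨s, hs⟩ := ih
        exact hcon k s hs
    obtain ⟨s, hs⟩ := this (Fintype.card V)
    have h1 : (Finset.range (2 * Fintype.card V + 1)).card ≤ (Finset.univ : Finset V).card := by
      apply Finset.card_le_card_of_injOn s (by simp)
      intro x hx y hy hxy
      simp only [Finset.coe_range, Set.mem_Iio] at hx hy
      exact hs.inj x y (by omega) (by omega) hxy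
    rw [Finset.card_range, Finset.card_univ] at h1
    omega
  have hr1 : 1 ≤ r := by omega
  have hreach := fun q hq ha => Saw.reach hr1 hp hα hC hs q hq ha
  -- neighbours of the end on the saw
  set A := (Finset.range (2 * k + 1)).filter (fun q => G.Adj (s 0) (s q)) with hA
  have hAm : ∀ q, q ∈ A ↔ q ≤ 2 * k ∧ G.Adj (s 0) (s q) := by
    intro q
    simp [hA, Nat.lt_succ_iff]
  have hA0 : ∀ q ∈ A, 1 ≤ q := by
    intro q hq
    rcases Nat.eq_zero_or_pos q with h | h
    · subst h
      exact absurd ((hAm 0).1 hq).2 (G.irrefl)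
    · exact h
  have hAc : p ≤ A.card + r := by
    have h1 : (Finset.univ.filter
        (fun z => G.Adj (s 0) z ∧ ∀ q, q ≤ 2 * k → s q ≠ z)).card + 1 ≤ r := by
      apply card_lt_of_indep hα
      intro x hx y hy hxy hadj
      simp only [Finset.mem_filter, Finset.mem_univ, true_and] at hx hy
      exact hmax _ (hs.extend x y hx.2 hy.2 hx.1 hy.1 hadj)
    have h2 : Finset.univ.filter (fun z => G.Adj (s 0) z) ⊆ A.image s ∪ (Finset.univ.filter
        (fun z => G.Adj (s 0) z ∧ ∀ q, q ≤ 2 * k → s q ≠ z)) := by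
      intro z hz
      simp only [Finset.mem_filter, Finset.mem_univ, true_and] at hz
      simp only [Finset.mem_union, Finset.mem_image, Finset.mem_filter, Finset.mem_univ, true_and]
      by_cases hq : ∃ q, q ≤ 2 * k ∧ s q = z
      · obtain ⟨q, hq, rfl⟩ := hq
        exact Or.inl ⟨q, (hAm q).2 ⟨hq, hz⟩, rfl⟩
      · push Not at hq
        exact Or.inr ⟨hz, hq⟩
    have h3 := Finset.card_le_card h2
    have h4 := Finset.card_union_le (A.image s) (Finset.univ.filter
        (fun z => G.Adj (s 0) z ∧ ∀ q, q ≤ 2 * k → s q ≠ z))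
    have h5 : (A.image s).card ≤ A.card := Finset.card_image_le
    have h6 := hdeg (s 0)
    omega
  have hAne : A.Nonempty := Finset.card_pos.1 (by omega)
  obtain ⟨M, hMA, hMmax⟩ := Finset.exists_max_image A id hAne
  have hM := (hAm M).1 hMA
  have hM1 := hA0 M hMA
  have hMp := hreach M hM.1 hM.2
  have hk : 0 < k := by omega
  -- the last complete tooth
  obtain ⟨j, hj, hjmax⟩ := Finset.exists_max_image
    ((Finset.range k).filter
      (fun j => G.Adj (s 0) (s (2 * j + 1)) ∧ G.Adj (s 0) (s (2 * j + 2)))) id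
    ⟨0, by simpa [hk] using ⟨hs.a01 0 hk, hs.a02 0 hk⟩⟩
  simp only [Finset.mem_filter, Finset.mem_range, id] at hj hjmax hMmax
  have hjM : 2 * j + 2 ≤ M := hMmax _ ((hAm _).2 ⟨by omega, hj.2.2⟩)
  have hdown : ∀ n, n ≤ j → G.Adj (s 0) (s (2 * (j - n) + 1)) ∧ G.Adj (s 0) (s (2 * (j - n) + 2)) := by
    intro n
    induction n with
    | zero => intro _; exact hj.2
    | succ n ih =>
      intro hn
      obtain ⟨a, b⟩ := ih (by omega)
      have e1 := hs.isEnd_rot (p := p) (j - n) (by omega) (by omega) a b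
      have e2 := hs.isEnd_rot_one (p := p) (j - n) (by omega) (by omega) (by omega) a b
      have e0 := hs.isEnd_zero p
      have d1 := ends_adj hr1 hp hα hC hmax hnon e0 e1 (fun h => by
        have := hs.inj _ _ (by omega) (by omega) h
        omega)
      have d2 := ends_adj hr1 hp hα hC hmax hnon e0 e2 (fun h => by
        have := hs.inj _ _ (by omega) (by omega) h
        omega)
      rw [show 2 * (j - (n + 1)) + 1 = 2 * (j - n) - 1 by omega,
        show 2 * (j - (n + 1)) + 2 = 2 * (j - n) by omega]
      exact ⟨d2, d1⟩
  have hends : ∀ q, q ≤ 2 * j → IsEnd G s k p (s q) := by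
    intro q hq
    rcases Nat.even_or_odd' q with ⟨i, rfl | rfl⟩
    · have := hdown (j - i) (by omega)
      rw [show j - (j - i) = i by omega] at this
      exact hs.isEnd_rot i (by omega) (by omega) this.1 this.2
    · have := hdown (j - (i + 1)) (by omega)
      rw [show j - (j - (i + 1)) = i + 1 by omega] at this
      exact hs.isEnd_rot_one (i + 1) (by omega) (by omega) (by omega) this.1 this.2
  -- counting
  have hcount : 2 * A.card ≤ 2 * j + M + 3 := by
    have h1 : (A.filter (fun q => q ≤ 2 * j + 2)).card ≤ 2 * j + 2 := by
      have : A.filter (fun q => q ≤ 2 * j + 2) ⊆ Finset.Icc 1 (2 * j + 2) := by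
        intro q hq
        rw [Finset.mem_filter] at hq
        exact Finset.mem_Icc.2 ⟨hA0 q hq.1, hq.2⟩
      simpa using Finset.card_le_card this
    have h2 : (A.filter (fun q => ¬ q ≤ 2 * j + 2)).card ≤
        (Finset.Icc (j + 1) ((M - 1) / 2)).card := by
      apply Finset.card_le_card_of_injOn (fun q => (q - 1) / 2)
      · intro q hq
        have hq := Finset.mem_filter.1 (Finset.mem_coe.1 hq)
        have := hMmax q hq.1
        simp only [Finset.coe_Icc, Set.mem_Icc]
        omega
      · have key : ∀ q q', q ∈ A → q' ∈ A → 2 * j + 2 < q → q < q' →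
            (q - 1) / 2 = (q' - 1) / 2 → False := by
          intro q q' hq hq' hqj hlt heq
          have a := (hAm q).1 hq
          have b := (hAm q').1 hq'
          obtain ⟨i, hi⟩ : ∃ i, i = (q - 1) / 2 := ⟨_, rfl⟩
          have c1 : q = 2 * i + 1 := by omega
          have c2 : q' = 2 * i + 2 := by omega
          rw [c1] at a
          rw [c2] at b
          have := hjmax i ⟨by omega, a.2, b.2⟩
          omega
        intro q hq q' hq' heq
        have hq := Finset.mem_filter.1 (Finset.mem_coe.1 hq)
        have hq' := Finset.mem_filter.1 (Finset.mem_coe.1 hq')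
        simp only at heq
        rcases lt_trichotomy q q' with h | h | h
        · exact (key q q' hq.1 hq'.1 (by omega) h heq).elim
        · exact h
        · exact (key q' q hq'.1 hq.1 (by omega) h heq.symm).elim
    rw [Nat.card_Icc] at h2
    have h3 := Finset.card_filter_add_card_filter_not (s := A) (fun q => q ≤ 2 * j + 2)
    omega
  -- the clique and the segment
  have himg : ∀ n, n ≤ 2 * k + 1 → ((Finset.range n).image s).card = n := by
    intro n hn
    rw [Finset.card_image_of_injOn, Finset.card_range]
    intro x hx y hy hxy
    simp only [Finset.coe_range, Set.mem_Iio] at hx hy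
    exact hs.inj x y (by omega) (by omega) hxy
  set W := (Finset.range (2 * j + 1)).image s with hWdef
  set Z := (Finset.range (M + 1)).image s with hZdef
  have hWc : W.card = 2 * j + 1 := himg _ (by omega)
  have hZc : Z.card = M + 1 := himg _ (by omega)
  have hWZ : W ⊆ Z := Finset.image_subset_image (Finset.range_subset_range.2 (by omega))
  have hWend : ∀ w ∈ W, IsEnd G s k p w := by
    intro w hw
    obtain ⟨q, hq, rfl⟩ := Finset.mem_image.1 hw
    exact hends q (by simp at hq; omega)
  obtain ⟨l, hl, hlm, hlen⟩ := augment hr hα W Z hWZ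
    (fun x hx y hy hxy => ends_adj hr1 hp hα hC hmax hnon (hWend x hx) (hWend y hy) hxy)
    (p - 1 - M) (s 0) (s (2 * j))
    (Finset.mem_image_of_mem _ (by simp)) (Finset.mem_image_of_mem _ (by simp))
    (fun h => by
      have := hs.inj _ _ (by omega) (by omega) h
      omega) (by omega)
    (by
      intro w hw
      have h1 := hdeg w
      have h2 : ((Finset.univ.filter (fun z => G.Adj w z)) ∩ Z).card ≤ (Z.erase w).card := by
        apply Finset.card_le_card
        intro z hz
        simp only [Finset.mem_inter, Finset.mem_filter, Finset.mem_univ, true_and] at hz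
        exact Finset.mem_erase.2 ⟨hz.1.ne', hz.2⟩
      rw [Finset.card_erase_of_mem (hWZ hw)] at h2
      have h3 := Finset.card_sdiff_add_card_inter (Finset.univ.filter (fun z => G.Adj w z)) Z
      omega)
    (by omega)
  obtain ⟨l2, hl2, hlen2, hm2⟩ := hs.straight (2 * j + 1) (M - (2 * j + 1)) (by omega)
  rw [show 2 * j + 1 + (M - (2 * j + 1)) = M by omega] at hl2 hm2
  have hfin := hl.append hl2 (hs.adj_succ (2 * j) (by omega)) (by
    intro x hx hx2
    obtain ⟨q, a, b, rfl⟩ := hm2 x hx2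
    rcases hlm _ hx with h | h
    · obtain ⟨q', hq', e⟩ := Finset.mem_image.1 h
      rw [Finset.mem_range] at hq'
      have := hs.inj _ _ (by omega) (by omega) e
      omega
    · exact h (Finset.mem_image_of_mem _ (Finset.mem_range.2 (by omega))))
  have hlen' : (l ++ l2).length = p := by
    rw [List.length_append]
    omega
  have := hfin.cycle (by omega) hM.2.symm
  rw [hlen'] at this
  exact hC this

end core

section main
variable {V : Type*} {G : SimpleGraph V}

theorem cycle_of_induce {n : ℕ} (S : Set V) (h : hasCycleOfOrder (G.induce S) n) :
    hasCycleOfOrder G n := by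
  obtain ⟨v, c, hc, hl⟩ := h
  let f := (SimpleGraph.Embedding.induce (G := G) S).toHom
  refine ⟨f v, c.map f, ?_, ?_⟩
  · exact hc.map (SimpleGraph.Embedding.induce (G := G) S).injective
  · rw [SimpleGraph.Walk.length_map, hl]

open Classical in
theorem indep_of_induce {n : ℕ} (B : Finset V) (hB : ∀ x ∈ B, ∀ y ∈ B, x ≠ y → ¬ G.Adj x y)
    (S : Set V) (hS : ∀ x ∈ S, x ∉ B ∧ ∀ b ∈ B, ¬ G.Adj b x)
    (h : hasIndepSetOfSize (G.induce S) n) : hasIndepSetOfSize G (n + B.card) := by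
  obtain ⟨t, ht, hind⟩ := h
  refine ⟨t.map (Function.Embedding.subtype _) ∪ B, ?_, ?_⟩
  · rw [Finset.card_union_of_disjoint, Finset.card_map, ht]
    rw [Finset.disjoint_left]
    intro x hx
    rw [Finset.mem_map] at hx
    obtain ⟨y, -, rfl⟩ := hx
    exact (hS _ y.2).1
  · intro x hx y hy hxy hadj
    rw [Finset.mem_union, Finset.mem_map] at hx hy
    rcases hx with ⟨x, hx, rfl⟩ | hx <;> rcases hy with ⟨y, hy, rfl⟩ | hy
    · exact hind x hx y hy (fun h => hxy (by rw [h])) hadj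
    · exact (hS _ x.2).2 y hy hadj.symm
    · exact (hS _ y.2).2 x hx hadj
    · exact hB x hx y hy hxy hadj

open Classical in
theorem upper_bound (p : ℕ) : ∀ (r : ℕ), 1 ≤ r → 4 * r + 2 ≤ p → ∀ (V : Type) [Fintype V]
    (G : SimpleGraph V), (p - 1) * (r - 1) + 1 ≤ Fintype.card V →
    hasCycleOfOrder G p ∨ hasIndepSetOfSize G r := by
  intro r
  induction r using Nat.strong_induction_on with
  | _ r ih =>
  intro hr hp V _ G hV
  -- removing the closed neighbourhood of a small independent set
  have hred : ∀ B : Finset V, (∀ x ∈ B, ∀ y ∈ B, x ≠ y → ¬ G.Adj x y) → 1 ≤ B.card → B.card < r →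
      (Finset.univ.filter (fun z => z ∈ B ∨ ∃ b ∈ B, G.Adj b z)).card ≤ B.card * (p - 1) →
      hasCycleOfOrder G p ∨ hasIndepSetOfSize G r := by
    intro B hB hB1 hBr hcard
    have h1 : Fintype.card {z // ¬ (z ∈ B ∨ ∃ b ∈ B, G.Adj b z)} =
        Fintype.card V - (Finset.univ.filter (fun z => z ∈ B ∨ ∃ b ∈ B, G.Adj b z)).card := by
      rw [Fintype.card_subtype_compl, Fintype.card_subtype]
    have hmul : (p - 1) * (r - 1) = B.card * (p - 1) + (p - 1) * (r - B.card - 1) := by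
      obtain ⟨d, hd⟩ : ∃ d, r = B.card + d + 1 := ⟨r - B.card - 1, by omega⟩
      rw [show r - B.card - 1 = d by omega, show r - 1 = B.card + d by omega]
      ring
    rcases ih (r - B.card) (by omega) (by omega) (by omega)
      {z // ¬ (z ∈ B ∨ ∃ b ∈ B, G.Adj b z)}
      (G.induce {z | ¬ (z ∈ B ∨ ∃ b ∈ B, G.Adj b z)}) (by
        rw [h1]
        omega) with h | h
    · exact Or.inl (cycle_of_induce _ h)
    · right
      have := indep_of_induce B hB _ (by
        intro x hx
        have hx : ¬ (x ∈ B ∨ ∃ b ∈ B, G.Adj b x) := hx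
        push Not at hx
        exact hx) h
      rwa [Nat.sub_add_cancel hBr.le] at this
  rcases Nat.lt_or_ge 1 r with hr2 | hr2
  · by_contra hcon
    push Not at hcon
    obtain ⟨hC, hα⟩ := hcon
    haveI : Nonempty V := Fintype.card_pos_iff.1 (by omega)
    refine core_false (G := G) hr2 hp hα hC ?_ ?_
    · intro x
      by_contra hlt
      rcases hred {x} (by simp) (by simp) (by simpa using hr2) (by
        have : (Finset.univ.filter (fun z => z ∈ ({x} : Finset V) ∨ ∃ b ∈ ({x} : Finset V), G.Adj b z)) ⊆
          insert x (Finset.univ.filter (fun z => G.Adj x z)) := by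
          intro z hz
          simpa using hz
        have h1 := Finset.card_le_card this
        have h2 := Finset.card_insert_le x (Finset.univ.filter (fun z => G.Adj x z))
        rw [Finset.card_singleton]
        omega) with h | h
      · exact hC h
      · exact hα h
    · intro a b hab hnadj
      by_contra hlt
      have hc2 : ({a, b} : Finset V).card = 2 := Finset.card_pair hab
      have hindep : ∀ x ∈ ({a, b} : Finset V), ∀ y ∈ ({a, b} : Finset V), x ≠ y → ¬ G.Adj x y := by
        intro x hx y hy hxy
        simp only [Finset.mem_insert, Finset.mem_singleton] at hx hy
        rcases hx with rfl | rfl <;> rcases hy with rfl | rfl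
        · exact G.irrefl
        · exact hnadj
        · exact fun h => hnadj h.symm
        · exact G.irrefl
      rcases Nat.lt_or_ge 2 r with hr3 | hr3
      · rcases hred {a, b} hindep (by omega) (by omega) (by
          have : (Finset.univ.filter (fun z => z ∈ ({a, b} : Finset V) ∨ ∃ c ∈ ({a, b} : Finset V), G.Adj c z)) ⊆
            (Finset.univ.filter (fun z => z = a ∨ z = b ∨ G.Adj a z ∨ G.Adj b z)) := by
            intro z hz
            simp only [Finset.mem_filter, Finset.mem_univ, true_and, Finset.mem_insert,
              Finset.mem_singleton, exists_eq_or_imp, exists_eq_left] at hz ⊢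
            tauto
          have h1 := Finset.card_le_card this
          rw [hc2]
          omega) with h | h
        · exact hC h
        · exact hα h
      · exact hα ⟨{a, b}, by omega, hindep⟩
  · right
    have hr1 : r = 1 := by omega
    obtain ⟨v⟩ : Nonempty V := Fintype.card_pos_iff.1 (by omega)
    refine ⟨{v}, by simp [hr1], ?_⟩
    intro x hx y hy hxy
    simp only [Finset.mem_singleton] at hx hy
    exact absurd (hx.trans hy.symm) hxy

theorem lower_bound (p r n : ℕ) (hr : 4 ≤ r) (hp : 4 * r + 2 ≤ p) (hn : n ≤ (p - 1) * (r - 1)) :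
    ∃ G : SimpleGraph (Fin n), ¬ hasCycleOfOrder G p ∧ ¬ hasIndepSetOfSize G r := by
  have hp0 : 0 < p - 1 := by omega
  let G : SimpleGraph (Fin n) :=
    { Adj := fun i j => i ≠ j ∧ i.val / (p - 1) = j.val / (p - 1)
      symm := ⟨fun i j h => ⟨h.1.symm, h.2.symm⟩⟩
      loopless := ⟨fun i h => h.1 rfl⟩ }
  refine ⟨G, ?_, ?_⟩
  · rintro ⟨v, c, hc, hl⟩
    have hsame : ∀ (u w : Fin n) (c : G.Walk u w), ∀ x ∈ c.support,
        x.val / (p - 1) = u.val / (p - 1) := by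
      intro u w c
      induction c with
      | nil => intro x hx; simp at hx; rw [hx]
      | cons h c ih =>
        intro x hx
        rw [SimpleGraph.Walk.support_cons, List.mem_cons] at hx
        rcases hx with rfl | hx
        · rfl
        · rw [ih x hx]
          exact h.2.symm
    have hnd := hc.support_nodup
    have hlen : c.support.tail.length = p := by simp [hl]
    have hcard : c.support.tail.toFinset.card = p := by
      rw [List.toFinset_card_of_nodup hnd, hlen]
    have : c.support.tail.toFinset.card ≤
        (Finset.Ico (v.val / (p - 1) * (p - 1)) (v.val / (p - 1) * (p - 1) + (p - 1))).card := by
      apply Finset.card_le_card_of_injOn (fun x => x.val)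
      · intro x hx
        have hx := List.mem_toFinset.1 (Finset.mem_coe.1 hx)
        have h1 := hsame v v c x (List.mem_of_mem_tail hx)
        have h2 := Nat.div_add_mod x.val (p - 1)
        have h3 := Nat.mod_lt x.val hp0
        rw [h1, Nat.mul_comm] at h2
        simp only [Finset.coe_Ico, Set.mem_Ico]
        omega
      · intro x _ y _ hxy
        exact Fin.ext hxy
    rw [Nat.card_Ico] at this
    omega
  · rintro ⟨t, ht, hind⟩
    have : t.card ≤ (Finset.range (r - 1)).card := by
      apply Finset.card_le_card_of_injOn (fun x => x.val / (p - 1))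
      · intro x _
        simp only [Finset.coe_range, Set.mem_Iio]
        rw [Nat.div_lt_iff_lt_mul hp0]
        have := x.2
        rw [Nat.mul_comm]
        omega
      · intro x hx y hy hxy
        by_contra hne
        exact hind x hx y hy hne ⟨hne, hxy⟩
    rw [Finset.card_range] at this
    omega

end main

/-- For all integers `r ≥ 4` and `p ≥ 4r + 2`, the Ramsey number satisfies
`r(C_p, K_r) = (p − 1)(r − 1) + 1`: the smallest `n` such that every graph on `n` vertices
contains a cycle of order `p` or an independent set of size `r` is `(p − 1)(r − 1) + 1`. -/
theorem cycle_complete_ramsey (p r : ℕ) (hr : 4 ≤ r) (hp : 4 * r + 2 ≤ p) :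
    IsLeast {n : ℕ | ∀ G : SimpleGraph (Fin n),
      hasCycleOfOrder G p ∨ hasIndepSetOfSize G r} ((p - 1) * (r - 1) + 1) := by

  constructor
  · intro G
    exact upper_bound p r (by omega) hp (Fin _) G (by simp)
  · intro n hn
    by_contra hlt
    obtain ⟨G, h1, h2⟩ := lower_bound p r n hr hp (by omega)
    rcases hn G with h | h
    · exact h1 h
    · exact h2 h
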